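/- Let C be a finite set of atoms π(z₁,z₂) where each π is an ICPDL program and z₁,z₂ are variables, such that the underlying graph of C is a clique and |vars(C)| ≤ 3. Then: (1) for any distinct x,y ∈ vars(C) there is an ICPDL program π_{C[x,y]} equivalent to the conjunctive program C[x,y]; and (2) for any x ∈ vars(C) there is an ICPDL program π_{C[x,x]} equivalent to C[x,x]. Moreover these ICPDL programs can be computed in polynomial time. -/

import Mathlib

set_option linter.unusedVariables false

/-! ## Kripke structures -/

/-- A Kripke structure with worlds `W`, atomic propositions `P` and atomic programs `A`. -/
structure Kripke (W P A : Type) where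
  rel : A → W → W → Prop
  val : P → W → Prop

/-! ## Syntax of `CPDL+` with loop and intersection (master language) -/

mutual
  /-- Formulas of loop/intersection CPDL+:  `p | ¬φ | φ∧φ | ⟨π⟩ | loop(π)`. -/
  inductive PDLFormula : Type where
    | prop  : ℕ → PDLFormula
    | neg   : PDLFormula → PDLFormula
    | conj  : PDLFormula → PDLFormula → PDLFormula
    | diam  : PDLProgram → PDLFormula
    | floop : PDLProgram → PDLFormula
  /-- Programs: `ε | a | ā | π∪π | π∘π | π* | φ? | π∩π | C[x_s,x_t]`. -/
  inductive PDLProgram : Type where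
    | eps    : PDLProgram
    | atom   : ℕ → PDLProgram
    | conv   : ℕ → PDLProgram
    | punion : PDLProgram → PDLProgram → PDLProgram
    | comp   : PDLProgram → PDLProgram → PDLProgram
    | star   : PDLProgram → PDLProgram
    | test   : PDLFormula → PDLProgram
    | inter  : PDLProgram → PDLProgram → PDLProgram
    | cprog  : AtomList → ℕ → ℕ → PDLProgram
  /-- A finite list of atoms `π(x,y)` (a "conjunctive program body" `C`). -/
  inductive AtomList : Type where
    | nil   : AtomList
    | acons : PDLProgram → ℕ → ℕ → AtomList → AtomList
end

/-! ## Semantics -/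

mutual
  /-- Satisfaction `⟦φ⟧_K ⊆ W`. -/
  def PDLFormula.sat {W : Type} (K : Kripke W ℕ ℕ) : PDLFormula → W → Prop
    | .prop p, w => K.val p w
    | .neg φ, w => ¬ PDLFormula.sat K φ w
    | .conj φ ψ, w => PDLFormula.sat K φ w ∧ PDLFormula.sat K ψ w
    | .diam π, w => ∃ v, PDLProgram.rel K π w v
    | .floop π, w => PDLProgram.rel K π w w
  termination_by φ _ => sizeOf φ
  /-- Binary relation `⟦π⟧_K ⊆ W × W`. -/
  def PDLProgram.rel {W : Type} (K : Kripke W ℕ ℕ) : PDLProgram → W → W → Prop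
    | .eps, u, v => u = v
    | .atom a, u, v => K.rel a u v
    | .conv a, u, v => K.rel a v u
    | .punion π ρ, u, v => PDLProgram.rel K π u v ∨ PDLProgram.rel K ρ u v
    | .comp π ρ, u, v => ∃ w, PDLProgram.rel K π u w ∧ PDLProgram.rel K ρ w v
    | .star π, u, v => Relation.ReflTransGen (fun a b => PDLProgram.rel K π a b) u v
    | .test φ, u, v => u = v ∧ PDLFormula.sat K φ u
    | .inter π ρ, u, v => PDLProgram.rel K π u v ∧ PDLProgram.rel K ρ u v
    | .cprog C xs xt, u, v => ∃ f : ℕ → W, f xs = u ∧ f xt = v ∧ AtomList.sat K C f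
  termination_by π _ _ => sizeOf π
  /-- `f` is a `C`-satisfying assignment. -/
  def AtomList.sat {W : Type} (K : Kripke W ℕ ℕ) : AtomList → (ℕ → W) → Prop
    | .nil, _ => True
    | .acons π x y C, f => PDLProgram.rel K π (f x) (f y) ∧ AtomList.sat K C f
  termination_by C _ => sizeOf C
end

/-- Semantic equivalence of formulas (on every Kripke structure). -/
def FormEquiv (φ ψ : PDLFormula) : Prop :=
  ∀ (W : Type) (K : Kripke W ℕ ℕ) (w : W), φ.sat K w ↔ ψ.sat K w

/-- Semantic equivalence of programs (on every Kripke structure). -/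
def ProgEquiv (π ρ : PDLProgram) : Prop :=
  ∀ (W : Type) (K : Kripke W ℕ ℕ) (u v : W), π.rel K u v ↔ ρ.rel K u v

/-! ## Graphs (undirected, possibly with self-loops), tree decompositions -/

/-- An undirected graph (self-loop edges are allowed; `adj` is intended symmetric). -/
structure UGraph (V : Type) where
  verts : Set V
  adj : V → V → Prop

/-- Connectedness of a graph. -/
def UGraph.Connected {V : Type} (G : UGraph V) : Prop :=
  G.verts.Nonempty ∧ ∀ x ∈ G.verts, ∀ y ∈ G.verts, Relation.ReflTransGen G.adj x y

/-- Graph isomorphism (between graphs on possibly different vertex types). -/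
def UGraph.Iso {V V' : Type} (G : UGraph V) (H : UGraph V') : Prop :=
  ∃ f : V → V', Set.BijOn f G.verts H.verts ∧
    ∀ x ∈ G.verts, ∀ y ∈ G.verts, (G.adj x y ↔ H.adj (f x) (f y))

/-- A tree decomposition of a (possibly infinite) graph. -/
structure TreeDecomp {V : Type} (G : UGraph V) where
  ι : Type
  T : SimpleGraph ι
  isTree : T.IsTree
  bag : ι → Set V
  cov_vert : ∀ v ∈ G.verts, ∃ b, v ∈ bag b
  cov_edge : ∀ x y, G.adj x y → ∃ b, x ∈ bag b ∧ y ∈ bag b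
  conn : ∀ (v : V) (b b' : ι), v ∈ bag b → v ∈ bag b' →
    Relation.ReflTransGen (fun c c' => T.Adj c c' ∧ v ∈ bag c ∧ v ∈ bag c') b b'

/-- The decomposition has width ≤ k (all bags have at most k+1 elements). -/
def TreeDecomp.WidthLE {V : Type} {G : UGraph V} (td : TreeDecomp G) (k : ℕ) : Prop :=
  ∀ b, (td.bag b).Finite ∧ (td.bag b).ncard ≤ k + 1

/-- The graph has tree-width ≤ k. -/
def UGraph.TreewidthLE {V : Type} (G : UGraph V) (k : ℕ) : Prop :=
  ∃ td : TreeDecomp G, td.WidthLE k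

/-- `TWₖ`: the class of finite graphs of tree-width at most `k`. -/
def TWClass (k : ℕ) : Set (UGraph ℕ) :=
  {G | G.verts.Finite ∧ G.TreewidthLE k}

/-! ## Underlying graphs of conjunctive programs, fragments -/

/-- The list of atoms `(π, x, y)` of `C`. -/
def AtomList.toList : AtomList → List (PDLProgram × ℕ × ℕ)
  | .nil => []
  | .acons π x y C => (π, x, y) :: C.toList

/-- The variables occurring in `C`. -/
def AtomList.vars (C : AtomList) : Set ℕ :=
  {z | ∃ e ∈ C.toList, z = e.2.1 ∨ z = e.2.2}

/-- The underlying graph `G_C` of a set of atoms `C`. -/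
def AtomList.graphC (C : AtomList) : UGraph ℕ where
  verts := C.vars
  adj x y := ∃ e ∈ C.toList, (x = e.2.1 ∧ y = e.2.2) ∨ (x = e.2.2 ∧ y = e.2.1)

/-- The underlying graph `G_{C[x_s,x_t]}`: `G_C` together with the edge `{x_s,x_t}`. -/
def cprogGraph (C : AtomList) (xs xt : ℕ) : UGraph ℕ where
  verts := C.vars
  adj x y := C.graphC.adj x y ∨ (x = xs ∧ y = xt) ∨ (x = xt ∧ y = xs)

mutual
  /-- Syntactic fragment predicate: `L` allows `loop`, `I` allows `∩`, `N` allows `¬`,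
  and every conjunctive program must be well-formed with underlying graph in
  (isomorphic to a member of) the class `𝒢`. -/
  def PDLFormula.OK (L I N : Bool) (𝒢 : Set (UGraph ℕ)) : PDLFormula → Prop
    | .prop _ => True
    | .neg φ => N = true ∧ PDLFormula.OK L I N 𝒢 φ
    | .conj φ ψ => PDLFormula.OK L I N 𝒢 φ ∧ PDLFormula.OK L I N 𝒢 ψ
    | .diam π => PDLProgram.OK L I N 𝒢 π
    | .floop π => L = true ∧ PDLProgram.OK L I N 𝒢 π
  def PDLProgram.OK (L I N : Bool) (𝒢 : Set (UGraph ℕ)) : PDLProgram → Prop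
    | .eps => True
    | .atom _ => True
    | .conv _ => True
    | .punion π ρ => PDLProgram.OK L I N 𝒢 π ∧ PDLProgram.OK L I N 𝒢 ρ
    | .comp π ρ => PDLProgram.OK L I N 𝒢 π ∧ PDLProgram.OK L I N 𝒢 ρ
    | .star π => PDLProgram.OK L I N 𝒢 π
    | .test φ => PDLFormula.OK L I N 𝒢 φ
    | .inter π ρ => I = true ∧ PDLProgram.OK L I N 𝒢 π ∧ PDLProgram.OK L I N 𝒢 ρ
    | .cprog C xs xt =>
        xs ∈ C.vars ∧ xt ∈ C.vars ∧ (C.graphC).Connected ∧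
        (∃ H ∈ 𝒢, (cprogGraph C xs xt).Iso H) ∧ AtomList.OK L I N 𝒢 C
  def AtomList.OK (L I N : Bool) (𝒢 : Set (UGraph ℕ)) : AtomList → Prop
    | .nil => True
    | .acons π _ _ C => PDLProgram.OK L I N 𝒢 π ∧ AtomList.OK L I N 𝒢 C
end

/-- The class of all graphs (no restriction on conjunctive programs). -/
def FullClass : Set (UGraph ℕ) := Set.univ

/-- The single-vertex graph with a self-loop. -/
def loopGraph : UGraph ℕ := ⟨{0}, fun x y => x = 0 ∧ y = 0⟩

/-- The two-vertex graph with one edge. -/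
def capGraph : UGraph ℕ := ⟨{0, 1}, fun x y => (x = 0 ∧ y = 1) ∨ (x = 1 ∧ y = 0)⟩

def GraphLoopClass : Set (UGraph ℕ) := {loopGraph}
def GraphCapClass : Set (UGraph ℕ) := {capGraph}

/-- `CPDL+` formulas: no loop, no intersection, arbitrary conjunctive programs. -/
def IsCPDLPlusFormula (φ : PDLFormula) : Prop := PDLFormula.OK false false true FullClass φ
def IsCPDLPlusProgram (π : PDLProgram) : Prop := PDLProgram.OK false false true FullClass π
/-- `ICPDL+` formulas: intersection plus arbitrary conjunctive programs. -/
def IsICPDLPlusFormula (φ : PDLFormula) : Prop := PDLFormula.OK false true true FullClass φ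
def IsICPDLPlusProgram (π : PDLProgram) : Prop := PDLProgram.OK false true true FullClass π
/-- `ICPDL` formulas: intersection, no conjunctive programs. -/
def IsICPDLFormula (φ : PDLFormula) : Prop := PDLFormula.OK false true true ∅ φ
def IsICPDLProgram (π : PDLProgram) : Prop := PDLProgram.OK false true true ∅ π

/-! ## Underlying graph / tree-width of Kripke structures -/

/-- `u` is at distance ≤ 1 from `v` in (the underlying undirected graph of) `K`. -/
def Kripke.Near {W P A : Type} (K : Kripke W P A) (u v : W) : Prop :=
  u = v ∨ ∃ a, K.rel a u v ∨ K.rel a v u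

/-- The underlying undirected graph of a Kripke structure. -/
def Kripke.graph {W P A : Type} (K : Kripke W P A) : UGraph W :=
  ⟨Set.univ, fun u v => ∃ a, K.rel a u v ∨ K.rel a v u⟩

/-- A Kripke structure has tree-width ≤ k. -/
def Kripke.TreewidthLE {W P A : Type} (K : Kripke W P A) (k : ℕ) : Prop :=
  K.graph.TreewidthLE k

/-- Every world has finitely many neighbours at distance ≤ 1. -/
def Kripke.FiniteDegree {W P A : Type} (K : Kripke W P A) : Prop :=
  ∀ u : W, {v | K.Near u v}.Finite



def PDLProgram.rev : PDLProgram → PDLProgram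
  | .eps => .eps
  | .atom a => .conv a
  | .conv a => .atom a
  | .punion π ρ => .punion π.rev ρ.rev
  | .comp π ρ => .comp ρ.rev π.rev
  | .star π => .star π.rev
  | .test φ => .test φ
  | .inter π ρ => .inter π.rev ρ.rev
  | .cprog C xs xt => .cprog C xt xs

theorem rev_rel {W : Type} (K : Kripke W ℕ ℕ) : ∀ (π : PDLProgram) (u v : W),
    π.rev.rel K u v ↔ π.rel K v u
  | .eps, u, v => by simp only [PDLProgram.rev, PDLProgram.rel]; exact eq_comm
  | .atom a, u, v => by simp only [PDLProgram.rev, PDLProgram.rel]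
  | .conv a, u, v => by simp only [PDLProgram.rev, PDLProgram.rel]
  | .punion π ρ, u, v => by
      simp only [PDLProgram.rev, PDLProgram.rel, rev_rel K π, rev_rel K ρ]
  | .comp π ρ, u, v => by
      simp only [PDLProgram.rev, PDLProgram.rel, rev_rel K π, rev_rel K ρ, and_comm]
  | .star π, u, v => by
      simp only [PDLProgram.rev, PDLProgram.rel, rev_rel K π]
      exact Relation.reflTransGen_swap
  | .test φ, u, v => by
      simp only [PDLProgram.rev, PDLProgram.rel]
      constructor <;> (rintro ⟨rfl, h⟩; exact ⟨rfl, h⟩)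
  | .inter π ρ, u, v => by
      simp only [PDLProgram.rev, PDLProgram.rel, rev_rel K π, rev_rel K ρ]
  | .cprog C xs xt, u, v => by
      simp only [PDLProgram.rev, PDLProgram.rel]
      constructor <;> (rintro ⟨f, h1, h2, h3⟩; exact ⟨f, h2, h1, h3⟩)

theorem rev_OK : ∀ (π : PDLProgram), IsICPDLProgram π → IsICPDLProgram π.rev
  | .eps, h => by simp [IsICPDLProgram, PDLProgram.rev, PDLProgram.OK]
  | .atom a, h => by simp [IsICPDLProgram, PDLProgram.rev, PDLProgram.OK]
  | .conv a, h => by simp [IsICPDLProgram, PDLProgram.rev, PDLProgram.OK]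
  | .punion π ρ, h => by
      simp only [IsICPDLProgram, PDLProgram.rev, PDLProgram.OK] at h ⊢
      exact ⟨rev_OK π h.1, rev_OK ρ h.2⟩
  | .comp π ρ, h => by
      simp only [IsICPDLProgram, PDLProgram.rev, PDLProgram.OK] at h ⊢
      exact ⟨rev_OK ρ h.2, rev_OK π h.1⟩
  | .star π, h => by
      simp only [IsICPDLProgram, PDLProgram.rev, PDLProgram.OK] at h ⊢
      exact rev_OK π h
  | .test φ, h => h
  | .inter π ρ, h => by
      simp only [IsICPDLProgram, PDLProgram.rev, PDLProgram.OK] at h ⊢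
      exact ⟨trivial, rev_OK π h.2.1, rev_OK ρ h.2.2⟩
  | .cprog C xs xt, h => by
      simp [IsICPDLProgram, PDLProgram.OK] at h

theorem rev_size : ∀ (π : PDLProgram), sizeOf π.rev = sizeOf π
  | .eps => by simp [PDLProgram.rev]
  | .atom a => by simp [PDLProgram.rev]
  | .conv a => by simp [PDLProgram.rev]
  | .punion π ρ => by simp [PDLProgram.rev, rev_size π, rev_size ρ]
  | .comp π ρ => by simp [PDLProgram.rev, rev_size π, rev_size ρ]; omega
  | .star π => by simp [PDLProgram.rev, rev_size π]
  | .test φ => by simp [PDLProgram.rev]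
  | .inter π ρ => by simp [PDLProgram.rev, rev_size π, rev_size ρ]
  | .cprog C xs xt => by simp [PDLProgram.rev]; omega

theorem sat_iff {W : Type} (K : Kripke W ℕ ℕ) (f : ℕ → W) : ∀ (C : AtomList),
    C.sat K f ↔ ∀ e ∈ C.toList, e.1.rel K (f e.2.1) (f e.2.2)
  | .nil => by simp [AtomList.sat, AtomList.toList]
  | .acons π x y C => by simp [AtomList.sat, AtomList.toList, sat_iff K f C]

theorem mem_OK : ∀ (C : AtomList), AtomList.OK false true true ∅ C →
    ∀ e ∈ C.toList, IsICPDLProgram e.1 ∧ sizeOf e.1 ≤ sizeOf C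
  | .nil, _ => by simp [AtomList.toList]
  | .acons π x y C, h => by
      simp only [AtomList.OK] at h
      intro e he
      simp only [AtomList.toList, List.mem_cons] at he
      rcases he with rfl | he
      · refine ⟨h.1, ?_⟩
        simp; omega
      · have := mem_OK C h.2 e he
        refine ⟨this.1, ?_⟩
        simp; omega

def MeetSpec (C : AtomList) (x y : ℕ) {W : Type} (K : Kripke W ℕ ℕ) (u v : W) : Prop :=
  ∀ e ∈ C.toList, (e.2.1 = x → e.2.2 = y → e.1.rel K u v) ∧
    (e.2.1 = y → e.2.2 = x → e.1.rel K v u)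

theorem opt_inter (p : Prop) (A π : PDLProgram) (hA : IsICPDLProgram A) (hπ : IsICPDLProgram π) :
    ∃ M : PDLProgram, IsICPDLProgram M ∧ sizeOf M ≤ sizeOf A + sizeOf π + 1 ∧
      ∀ (W : Type) (K : Kripke W ℕ ℕ) (u v : W), M.rel K u v ↔ A.rel K u v ∧ (p → π.rel K u v) := by
  by_cases hp : p
  · refine ⟨.inter A π, ?_, ?_, ?_⟩
    · simp only [IsICPDLProgram, PDLProgram.OK]; exact ⟨trivial, hA, hπ⟩
    · simp; omega
    · intro W K u v; simp [PDLProgram.rel, hp]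
  · exact ⟨A, hA, by omega, by intro W K u v; simp [hp]⟩

theorem exists_meet (x y : ℕ) (seed : PDLProgram) (hs : IsICPDLProgram seed) : ∀ (C : AtomList),
    AtomList.OK false true true ∅ C →
    ∃ M : PDLProgram, IsICPDLProgram M ∧ sizeOf M ≤ sizeOf seed + 2 * sizeOf C ∧
      ∀ (W : Type) (K : Kripke W ℕ ℕ) (u v : W),
        M.rel K u v ↔ seed.rel K u v ∧ MeetSpec C x y K u v
  | .nil, _ => ⟨seed, hs, by omega, by simp [MeetSpec, AtomList.toList]⟩
  | .acons π a b C, h => by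
      simp only [AtomList.OK] at h
      obtain ⟨M, h1, h2, h3⟩ := exists_meet x y seed hs C h.2
      obtain ⟨M', h1', h2', h3'⟩ := opt_inter (a = x ∧ b = y) M π h1 h.1
      obtain ⟨M'', h1'', h2'', h3''⟩ := opt_inter (a = y ∧ b = x) M' π.rev h1' (rev_OK π h.1)
      rw [rev_size] at h2''
      refine ⟨M'', h1'', ?_, ?_⟩
      · simp; omega
      · intro W K u v
        rw [h3'', h3', h3]
        simp only [MeetSpec, AtomList.toList, List.forall_mem_cons, rev_rel]
        tauto

theorem exists_loop (C : AtomList) (hC : AtomList.OK false true true ∅ C) (x : ℕ) :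
    ∃ M : PDLProgram, IsICPDLProgram M ∧ sizeOf M ≤ 2 * sizeOf C + 1 ∧
      ∀ (W : Type) (K : Kripke W ℕ ℕ) (u v : W),
        M.rel K u v ↔ u = v ∧ MeetSpec C x x K u v := by
  obtain ⟨M, h1, h2, h3⟩ := exists_meet x x .eps (by simp [IsICPDLProgram, PDLProgram.OK]) C hC
  refine ⟨M, h1, ?_, ?_⟩
  · simp at h2; omega
  · intro W K u v; rw [h3]; simp only [PDLProgram.rel]

theorem exists_edge (C : AtomList) (hC : AtomList.OK false true true ∅ C) (x y : ℕ)
    (hadj : C.graphC.adj x y) :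
    ∃ M : PDLProgram, IsICPDLProgram M ∧ sizeOf M ≤ 3 * sizeOf C ∧
      ∀ (W : Type) (K : Kripke W ℕ ℕ) (u v : W),
        M.rel K u v ↔ MeetSpec C x y K u v := by
  obtain ⟨e, he, h⟩ := hadj
  obtain ⟨ho, hz⟩ := mem_OK C hC e he
  rcases h with ⟨rfl, rfl⟩ | ⟨rfl, rfl⟩
  · obtain ⟨M, h1, h2, h3⟩ := exists_meet e.2.1 e.2.2 e.1 ho C hC
    refine ⟨M, h1, by omega, ?_⟩
    intro W K u v; rw [h3]
    exact ⟨fun h => h.2, fun h => ⟨(h e he).1 rfl rfl, h⟩⟩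
  · obtain ⟨M, h1, h2, h3⟩ := exists_meet e.2.2 e.2.1 e.1.rev (rev_OK _ ho) C hC
    rw [rev_size] at h2
    refine ⟨M, h1, by omega, ?_⟩
    intro W K u v; rw [h3, rev_rel]
    exact ⟨fun h => h.2, fun h => ⟨(h e he).2 rfl rfl, h⟩⟩

theorem meet_of_sat {C : AtomList} {W : Type} {K : Kripke W ℕ ℕ} {f : ℕ → W}
    (h : C.sat K f) (x y : ℕ) : MeetSpec C x y K (f x) (f y) := by
  rw [sat_iff] at h
  intro e he
  have := h e he
  constructor <;> (rintro rfl rfl; exact this)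

theorem sat_of_meet {C : AtomList} {W : Type} {K : Kripke W ℕ ℕ} {f : ℕ → W}
    (h : ∀ x ∈ C.vars, ∀ y ∈ C.vars, MeetSpec C x y K (f x) (f y)) : C.sat K f := by
  rw [sat_iff]
  intro e he
  exact (h e.2.1 ⟨e, he, Or.inl rfl⟩ e.2.2 ⟨e, he, Or.inr rfl⟩ e he).1 rfl rfl

theorem MeetSpec.symm {C : AtomList} {W : Type} {K : Kripke W ℕ ℕ} {u v : W} {x y : ℕ}
    (h : MeetSpec C x y K u v) : MeetSpec C y x K v u := fun e he => ⟨(h e he).2, (h e he).1⟩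

theorem main_edge (C : AtomList) (hC : AtomList.OK false true true ∅ C)
    (hcl : ∀ x ∈ C.vars, ∀ y ∈ C.vars, x ≠ y → C.graphC.adj x y)
    (hfin : C.vars.Finite) (hcard : C.vars.ncard ≤ 3)
    (x : ℕ) (hx : x ∈ C.vars) (y : ℕ) (hy : y ∈ C.vars) (hxy : x ≠ y) :
    ∃ π : PDLProgram, IsICPDLProgram π ∧ ProgEquiv π (PDLProgram.cprog C x y) ∧
          sizeOf π ≤ 20 * sizeOf C + 20 := by
  obtain ⟨Lx, ox, sx, rx⟩ := exists_loop C hC x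
  obtain ⟨Ly, oy, sy, ry⟩ := exists_loop C hC y
  obtain ⟨E, oE, sE, rE⟩ := exists_edge C hC x y (hcl x hx y hy hxy)
  by_cases hz : ∃ z ∈ C.vars, z ≠ x ∧ z ≠ y
  · obtain ⟨z, hz, hzx, hzy⟩ := hz
    have hv : ∀ a ∈ C.vars, a = x ∨ a = y ∨ a = z := by
      intro a ha
      by_contra hne
      push Not at hne
      have hsub : (({a, x, y, z} : Finset ℕ) : Set ℕ) ⊆ C.vars := by
        intro b hb
        simp at hb
        rcases hb with rfl | rfl | rfl | rfl <;> assumption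
      have h4 := Set.ncard_le_ncard hsub hfin
      rw [Set.ncard_coe_finset] at h4
      have : ({a, x, y, z} : Finset ℕ).card = 4 := by
        simp [Finset.card_insert_of_notMem, hne, hxy, hzx.symm, hzy.symm]
      omega
    obtain ⟨Lz, oz, sz, rz⟩ := exists_loop C hC z
    obtain ⟨F, oF, sF, rF⟩ := exists_edge C hC x z (hcl x hx z hz hzx.symm)
    obtain ⟨G, oG, sG, rG⟩ := exists_edge C hC z y (hcl z hz y hy hzy)
    refine ⟨.comp Lx (.comp (.inter E (.comp F (.comp Lz G))) Ly), ?_, ?_, ?_⟩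
    · simp only [IsICPDLProgram, PDLProgram.OK] at *
      exact ⟨ox, ⟨trivial, oE, oF, oz, oG⟩, oy⟩
    · intro W K u v
      simp only [PDLProgram.rel, rx, ry, rz, rE, rF, rG]
      constructor
      · rintro ⟨_, ⟨rfl, h1⟩, _, ⟨h2, w, h3, _, ⟨rfl, h4⟩, h5⟩, rfl, h6⟩
        refine ⟨fun n => if n = x then u else if n = y then _ else w, by simp,
          by simp [hxy.symm]; rfl, sat_of_meet ?_⟩
        intro a ha b hb
        rcases hv a ha with rfl | rfl | rfl <;> rcases hv b hb with rfl | rfl | rfl <;>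
          simp_all [MeetSpec.symm, hxy.symm]
      · rintro ⟨f, rfl, rfl, h⟩
        exact ⟨_, ⟨rfl, meet_of_sat h _ _⟩, _, ⟨meet_of_sat h _ _, f z, meet_of_sat h _ _,
          _, ⟨rfl, meet_of_sat h _ _⟩, meet_of_sat h _ _⟩, rfl, meet_of_sat h _ _⟩
    · simp; omega
  · push Not at hz
    have hv : ∀ a ∈ C.vars, a = x ∨ a = y := fun a ha => by
      by_cases h : a = x
      · exact Or.inl h
      · exact Or.inr (hz a ha h)
    refine ⟨.comp Lx (.comp E Ly), ?_, ?_, ?_⟩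
    · simp only [IsICPDLProgram, PDLProgram.OK] at *
      exact ⟨ox, oE, oy⟩
    · intro W K u v
      simp only [PDLProgram.rel, rx, ry, rE]
      constructor
      · rintro ⟨_, ⟨rfl, h1⟩, _, h2, rfl, h6⟩
        refine ⟨fun n => if n = x then u else _, by simp,
          by simp [hxy.symm]; rfl, sat_of_meet ?_⟩
        intro a ha b hb
        rcases hv a ha with rfl | rfl <;> rcases hv b hb with rfl | rfl <;>
          simp_all [MeetSpec.symm, hxy.symm]
      · rintro ⟨f, rfl, rfl, h⟩
        exact ⟨_, ⟨rfl, meet_of_sat h _ _⟩, _, meet_of_sat h _ _, rfl, meet_of_sat h _ _⟩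
    · simp; omega

theorem main_loop (C : AtomList) (hC : AtomList.OK false true true ∅ C)
    (hcl : ∀ x ∈ C.vars, ∀ y ∈ C.vars, x ≠ y → C.graphC.adj x y)
    (hfin : C.vars.Finite) (hcard : C.vars.ncard ≤ 3)
    (x : ℕ) (hx : x ∈ C.vars) :
    ∃ π : PDLProgram, IsICPDLProgram π ∧ ProgEquiv π (PDLProgram.cprog C x x) ∧
          sizeOf π ≤ 20 * sizeOf C + 22 := by
  by_cases hy : ∃ y ∈ C.vars, x ≠ y
  · obtain ⟨y, hy, hxy⟩ := hy
    obtain ⟨π, h1, h2, h3⟩ := main_edge C hC hcl hfin hcard x hx y hy hxy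
    refine ⟨.test (.diam π), ?_, ?_, ?_⟩
    · simpa only [IsICPDLProgram, PDLProgram.OK, PDLFormula.OK] using h1
    · intro W K u v
      simp only [PDLProgram.rel, PDLFormula.sat, h2 W K]
      constructor
      · rintro ⟨rfl, _, f, h, _, h'⟩
        exact ⟨f, h, h, h'⟩
      · rintro ⟨f, rfl, rfl, h⟩
        exact ⟨rfl, _, f, rfl, rfl, h⟩
    · simp; omega
  · push Not at hy
    obtain ⟨Lx, ox, sx, rx⟩ := exists_loop C hC x
    refine ⟨Lx, ox, ?_, by omega⟩
    intro W K u v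
    simp only [PDLProgram.rel, rx]
    constructor
    · rintro ⟨rfl, h⟩
      refine ⟨fun _ => u, rfl, rfl, sat_of_meet ?_⟩
      intro a ha b hb
      rw [← hy a ha, ← hy b hb]; exact h
    · rintro ⟨f, rfl, rfl, h⟩
      exact ⟨rfl, meet_of_sat h _ _⟩

/-- Lemma 3, "lemita", of the paper: if `C` is a finite set of atoms of
ICPDL programs whose underlying graph is a clique, with at most 3 variables, then for all
`x ≠ y` in `vars(C)` there is an ICPDL program equivalent to `C[x,y]`, and for all `x` in
`vars(C)` there is an ICPDL program equivalent to `C[x,x]`; these programs are computable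
in polynomial time (here: with a polynomial size bound). -/
theorem lemita :
    ∃ c : ℕ, ∀ C : AtomList,
      AtomList.OK false true true ∅ C →
      (∀ x ∈ C.vars, ∀ y ∈ C.vars, x ≠ y → C.graphC.adj x y) →
      C.vars.Finite → C.vars.ncard ≤ 3 →
      (∀ x ∈ C.vars, ∀ y ∈ C.vars, x ≠ y →
        ∃ π : PDLProgram, IsICPDLProgram π ∧ ProgEquiv π (PDLProgram.cprog C x y) ∧
          sizeOf π ≤ (sizeOf C + c) ^ c) ∧
      (∀ x ∈ C.vars,
        ∃ π : PDLProgram, IsICPDLProgram π ∧ ProgEquiv π (PDLProgram.cprog C x x) ∧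
          sizeOf π ≤ (sizeOf C + c) ^ c) := by
  have key : ∀ s : ℕ, 20 * s + 22 ≤ (s + 22) ^ 22 := fun s => calc
    20 * s + 22 ≤ (s + 22) ^ 2 := by nlinarith
    _ ≤ (s + 22) ^ 22 := Nat.pow_le_pow_right (by omega) (by norm_num)
  refine ⟨22, fun C hC hcl hfin hcard => ⟨fun x hx y hy hxy => ?_, fun x hx => ?_⟩⟩
  · obtain ⟨π, h1, h2, h3⟩ := main_edge C hC hcl hfin hcard x hx y hy hxy
    exact ⟨π, h1, h2, le_trans (by omega) (key _)⟩
  · obtain ⟨π, h1, h2, h3⟩ := main_loop C hC hcl hfin hcard x hx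
    exact ⟨π, h1, h2, h3.trans (key _)⟩
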